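/- Every injective topos is lex totally distributive: let C be a small category with finite limits and let E be a locally small category which is a retract, by geometric morphisms, of Ĉ, i.e., there exist functors s_* : E → Ĉ with a finite-limit-preserving left adjoint s* : Ĉ → E, and r_* : Ĉ → E with a finite-limit-preserving left adjoint r* : E → Ĉ, such that the composite of s_* followed by r_* is naturally isomorphic to the identity on E. Then E is lex totally distributive. -/

import Mathlib

open CategoryTheory CategoryTheory.Limits

universe v u

/-- A locally small category `E` is *lex totally distributive* if there exist functors
`t : E ⥤ Ê` and `c : Ê ⥤ E` with adjunctions `t ⊣ c` and `c ⊣ y_E`, with `t`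
preserving finite limits. -/
def LexTotallyDistributive (E : Type u) [Category.{v} E] : Prop :=
  ∃ (t : E ⥤ (Eᵒᵖ ⥤ Type v)) (c : (Eᵒᵖ ⥤ Type v) ⥤ E),
    Nonempty (t ⊣ c) ∧ Nonempty (c ⊣ yoneda) ∧ PreservesFiniteLimits t

open Opposite

namespace CategoryTheory

section Retracts

universe v₁ v₂ u₁ u₂

variable {A : Type u₁} [Category.{v₁} A] {B : Type u₂} [Category.{v₂} B]

/-- A category with equalizers is idempotent complete. -/
theorem isIdempotentComplete_of_hasEqualizers [HasEqualizers A] : IsIdempotentComplete A :=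
  (Idempotents.isIdempotentComplete_iff_hasEqualizer_of_id_and_idempotent A).2
    fun _ _ _ => inferInstance

/-- A category which is a retract (up to isomorphism) of an idempotent complete category is
idempotent complete. -/
theorem IsIdempotentComplete.of_comp_iso_id [IsIdempotentComplete B] (F : A ⥤ B) (G : B ⥤ A)
    (φ : F ⋙ G ≅ 𝟭 A) : IsIdempotentComplete A where
  idempotents_split X p hp := by
    obtain ⟨Y, i, e, h₁, h₂⟩ := IsIdempotentComplete.idempotents_split (F.obj X) (F.map p)
      (by rw [← F.map_comp, hp])
    refine ⟨G.obj Y, G.map i ≫ φ.hom.app X, φ.inv.app X ≫ G.map e, ?_, ?_⟩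
    · have := φ.hom_inv_id_app X
      dsimp at this
      rw [Category.assoc, reassoc_of% this, ← G.map_comp, h₁, G.map_id]
    · have := φ.hom.naturality p
      dsimp at this
      rw [Category.assoc, ← G.map_comp_assoc, h₂, this, Iso.inv_hom_id_app_assoc]

/-- Splitting of idempotents phrased in terms of retracts. -/
theorem IsIdempotentComplete.exists_retract [IsIdempotentComplete A] {X : A} (p : X ⟶ X)
    (hp : p ≫ p = p) : ∃ (Y : A) (h : Retract Y X), h.r ≫ h.i = p := by
  obtain ⟨Y, i, e, h₁, h₂⟩ := IsIdempotentComplete.idempotents_split X p hp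
  exact ⟨Y, ⟨i, e, h₁⟩, h₂⟩

theorem Retract.i_app_r_app {F G : A ⥤ B} (h : Retract F G) (X : A) :
    h.i.app X ≫ h.r.app X = 𝟙 (F.obj X) := by
  rw [← NatTrans.comp_app, h.retract, NatTrans.id_app]

theorem Retract.i_app_r_app_assoc {F G : A ⥤ B} (h : Retract F G) (X : A) {Z : B}
    (f : F.obj X ⟶ Z) : h.i.app X ≫ h.r.app X ≫ f = f := by
  rw [← Category.assoc, h.i_app_r_app, Category.id_comp]

/-- A retract of a functor preserving a limit preserves that limit. -/
theorem PreservesLimit.of_retract {J : Type*} [Category* J] {K : J ⥤ A} {F G : A ⥤ B}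
    (h : Retract F G) [PreservesLimit K G] : PreservesLimit K F where
  preserves {c} hc := by
    have hG := isLimitOfPreserves G hc
    let push (s : Cone (K ⋙ F)) : Cone (K ⋙ G) :=
      (Cone.postcompose (Functor.whiskerLeft K h.i)).obj s
    refine ⟨⟨fun s => hG.lift (push s) ≫ h.r.app c.pt, fun s j => ?_, fun s m hm => ?_⟩⟩
    · have h₁ := hG.fac (push s) j
      dsimp [push] at h₁ ⊢
      rw [Category.assoc, ← h.r.naturality, reassoc_of% h₁, h.i_app_r_app, Category.comp_id]
    · have h₁ : m ≫ h.i.app c.pt = hG.lift (push s) := by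
        refine hG.uniq (push s) _ fun j => ?_
        have := hm j
        dsimp [push] at this ⊢
        rw [Category.assoc, ← h.i.naturality, reassoc_of% this]
      rw [← h₁, Category.assoc, h.i_app_r_app]
      exact (Category.comp_id m).symm

/-- A retract of a functor preserving finite limits preserves finite limits. -/
theorem PreservesFiniteLimits.of_retract {F G : A ⥤ B} (h : Retract F G)
    [PreservesFiniteLimits G] : PreservesFiniteLimits F where
  preservesFiniteLimits _ _ _ := ⟨PreservesLimit.of_retract h⟩

/-- If an idempotent on a right adjoint and its conjugate on the left adjoint both split, then
the splittings are adjoint. -/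
def Adjunction.ofRetract {T t : A ⥤ B} {L c : B ⥤ A} (adj : T ⊣ L) (hc : Retract c L)
    (ht : Retract t T)
    (h : ht.r ≫ ht.i = (conjugateEquiv adj adj).symm (hc.r ≫ hc.i)) : t ⊣ c where
  unit := adj.unit ≫ Functor.whiskerRight ht.r L ≫ Functor.whiskerLeft t hc.r
  counit := Functor.whiskerLeft c ht.i ≫ Functor.whiskerRight hc.i T ≫ adj.counit
  left_triangle_components X := by
    have h₁ := conjugateEquiv_counit_symm adj adj (hc.r ≫ hc.i) (t.obj X)
    rw [← h] at h₁
    have h₃ := ht.i.naturality (adj.unit.app X ≫ L.map (ht.r.app X) ≫ hc.r.app (t.obj X))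
    have h₄ := adj.counit.naturality (ht.r.app X)
    have h₅ := fun {Y Z : A} (f : Y ⟶ Z) => ht.r.naturality f
    have h₆ := fun {Y Z : A} (f : Y ⟶ Z) => ht.i.naturality f
    dsimp at h₁ h₃ h₄ h₅ h₆ ⊢
    rw [T.map_comp, Category.assoc, Category.assoc] at h₁
    rw [reassoc_of% h₃]
    simp only [Functor.map_comp, Category.assoc]
    rw [h₁, reassoc_of% h₅, reassoc_of% h₅, reassoc_of% h₆, reassoc_of% h₆, h₄,
      adj.left_triangle_components_assoc, ht.i_app_r_app, Category.comp_id, ht.i_app_r_app]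
  right_triangle_components Y := by
    have h₁ := unit_conjugateEquiv_symm adj adj (hc.r ≫ hc.i) (c.obj Y)
    rw [← h] at h₁
    have h₃ := hc.r.naturality (ht.i.app (c.obj Y) ≫ T.map (hc.i.app Y) ≫ adj.counit.app Y)
    have h₄ := adj.unit.naturality (hc.i.app Y)
    have h₅ := fun {Y Z : B} (f : Y ⟶ Z) => hc.r.naturality f
    dsimp at h₁ h₃ h₄ h₅ ⊢
    rw [L.map_comp] at h₁
    simp only [Category.assoc]
    rw [← h₃]
    simp only [Functor.map_comp, Category.assoc]
    rw [← reassoc_of% h₁, h₅, reassoc_of% h₅, hc.i_app_r_app_assoc, ← reassoc_of% h₅, ← h₅,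
      ← reassoc_of% h₄, adj.right_triangle_components_assoc, hc.i_app_r_app]

/-- If `α` and `β` satisfy the triangle identity at `R`, then the endomorphism they induce
on `L` is idempotent. -/
theorem weakAdjunction_idempotent {R : A ⥤ B} {L : B ⥤ A} (α : 𝟭 B ⟶ L ⋙ R) (β : R ⋙ L ⟶ 𝟭 A)
    (h : ∀ X, α.app (R.obj X) ≫ R.map (β.app X) = 𝟙 (R.obj X)) :
    (Functor.whiskerRight α L ≫ Functor.whiskerLeft L β) ≫
      (Functor.whiskerRight α L ≫ Functor.whiskerLeft L β : L ⟶ L) =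
      Functor.whiskerRight α L ≫ Functor.whiskerLeft L β := by
  ext P
  have h₁ := β.naturality (L.map (α.app P))
  have h₂ := β.naturality (β.app (L.obj P))
  have h₃ := α.naturality (α.app P)
  dsimp at h₁ h₂ h₃ ⊢
  rw [Category.assoc, ← reassoc_of% h₁, ← h₂, ← L.map_comp_assoc, ← L.map_comp_assoc]
  simp [← h₃, h]

/-- Splitting the idempotent of `weakAdjunction_idempotent` gives a left adjoint of `R`. -/
def Adjunction.ofWeakAdjunction {R : A ⥤ B} {L c : B ⥤ A} (α : 𝟭 B ⟶ L ⋙ R)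
    (β : R ⋙ L ⟶ 𝟭 A) (h : ∀ X, α.app (R.obj X) ≫ R.map (β.app X) = 𝟙 (R.obj X))
    (hc : Retract c L)
    (hci : hc.r ≫ hc.i = Functor.whiskerRight α L ≫ Functor.whiskerLeft L β) : c ⊣ R where
  unit := α ≫ Functor.whiskerRight hc.r R
  counit := Functor.whiskerLeft R hc.i ≫ β
  left_triangle_components P := by
    have h₁ := congr_app hci P
    have h₂ := β.naturality (hc.r.app P)
    have h₃ := hc.i.naturality (α.app P)
    have h₄ := hc.i.naturality (R.map (hc.r.app P))
    dsimp at h₁ h₂ h₃ h₄ ⊢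
    rw [Functor.map_comp, Category.assoc, reassoc_of% h₄, reassoc_of% h₃, h₂, ← reassoc_of% h₁]
    simp [Retract.i_app_r_app]
  right_triangle_components X := by
    have h₁ := congr_app hci (R.obj X)
    have h₂ := β.naturality (β.app X)
    dsimp at h₁ h₂ ⊢
    rw [Category.assoc, ← R.map_comp, reassoc_of% h₁, ← h₂, ← L.map_comp_assoc, h,
      L.map_id, Category.id_comp, h]

end Retracts

section Lan

universe w w'

/-- If `F : C ⥤ D` is representably flat with `C` small and `D` locally small, then left Kan
extension of presheaves along `F.op` preserves finite limits. -/
theorem lan_op_preservesFiniteLimits_of_flat {C : Type w} [SmallCategory C] {D : Type w'}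
    [Category.{w} D] (F : C ⥤ D) [RepresentablyFlat F] :
    PreservesFiniteLimits (F.op.lan : (Cᵒᵖ ⥤ Type w) ⥤ (Dᵒᵖ ⥤ Type w)) := by
  apply preservesFiniteLimits_of_preservesFiniteLimitsOfSize.{w}
  intro J _ _
  apply preservesLimitsOfShape_of_evaluation _ J
  intro K
  have : IsFiltered (CostructuredArrow F.op K) :=
    IsFiltered.of_equivalence (structuredArrowOpEquivalence F (unop K))
  let e : F.op.lan ⋙ (evaluation Dᵒᵖ (Type w)).obj K ≅
      (Functor.whiskeringLeft _ _ _).obj (CostructuredArrow.proj F.op K) ⋙ colim :=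
    (NatIso.ofComponents (fun G => (F.op.leftKanExtensionObjIsoColimit G K).symm)
      (fun {G₁ G₂} φ => by
        refine colimit.hom_ext fun T => ?_
        have h₁ := fun (G : Cᵒᵖ ⥤ Type w) => F.op.ι_leftKanExtensionObjIsoColimit_inv G K T
        have h₂ := congr_app (F.op.lanUnit.naturality φ) T.left
        have h₃ := (F.op.lan.map φ).naturality T.hom
        dsimp [Functor.lan, Functor.lanUnit] at h₁ h₂ h₃ ⊢
        rw [ι_colimMap_assoc, reassoc_of% h₁, h₁]
        refine (congr_arg (· ≫ (F.op.leftKanExtension G₂).map T.hom) h₂).trans ?_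
        exact congr_arg ((F.op.leftKanExtensionUnit G₁).app T.left ≫ ·) h₃.symm)).symm
  exact preservesLimitsOfShape_of_natIso e.symm

end Lan

section Yoneda

universe w w'

variable {E : Type w'} [Category.{w} E]

/-- A retraction `L` of the Yoneda embedding receives a canonical transformation
`P ⟶ yoneda (L P)`, which sends `a : P A` to `A ≅ L (yoneda A) ⟶ L P`. -/
def toYonedaOfRetraction (L : (Eᵒᵖ ⥤ Type w) ⥤ E) (φ : yoneda ⋙ L ≅ 𝟭 E) :
    𝟭 (Eᵒᵖ ⥤ Type w) ⟶ L ⋙ yoneda where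
  app P :=
    { app A := ↾fun a => φ.inv.app A.unop ≫ L.map (yonedaEquiv.symm a)
      naturality A B f := by
        ext a
        have h := φ.inv.naturality f.unop
        dsimp at h ⊢
        rw [yonedaEquiv_symm_map, L.map_comp, reassoc_of% h] }
  naturality P Q g := by
    ext A a
    have h := yonedaEquiv_symm_naturality_right A.unop g a
    dsimp at h ⊢
    rw [Category.assoc, ← L.map_comp, h]

theorem toYonedaOfRetraction_app_comp (L : (Eᵒᵖ ⥤ Type w) ⥤ E) (φ : yoneda ⋙ L ≅ 𝟭 E) (X : E) :
    (toYonedaOfRetraction L φ).app (yoneda.obj X) ≫ yoneda.map (φ.hom.app X) =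
      𝟙 (yoneda.obj X) := by
  ext A f
  have h := φ.hom.naturality f
  have h' : yonedaEquiv.symm f = yoneda.map f := by
    rw [Equiv.symm_apply_eq, yonedaEquiv_yoneda_map]
  dsimp at h
  simp [toYonedaOfRetraction, h', h]

/-- If `L` is a retraction of the Yoneda embedding of an idempotent complete category, and `L` has
a finite-limit-preserving left adjoint, then the category is lex totally distributive. -/
theorem LexTotallyDistributive.of_retraction [IsIdempotentComplete E]
    (L : (Eᵒᵖ ⥤ Type w) ⥤ E) (φ : yoneda ⋙ L ≅ 𝟭 E) (T : E ⥤ (Eᵒᵖ ⥤ Type w)) (adj : T ⊣ L)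
    [PreservesFiniteLimits T] : LexTotallyDistributive E := by
  have h := toYonedaOfRetraction_app_comp L φ
  have : IsIdempotentComplete (Type w) := isIdempotentComplete_of_hasEqualizers
  have he := weakAdjunction_idempotent (toYonedaOfRetraction L φ) φ.hom h
  obtain ⟨c, hc, hci⟩ := IsIdempotentComplete.exists_retract _ he
  obtain ⟨t, ht, hti⟩ := IsIdempotentComplete.exists_retract
    ((conjugateEquiv adj adj).symm (hc.r ≫ hc.i)) (by
      rw [conjugateEquiv_symm_comp, Category.assoc, hc.retract_assoc])
  exact ⟨t, c, ⟨adj.ofRetract hc ht hti⟩, ⟨Adjunction.ofWeakAdjunction _ _ h hc hci⟩,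
    PreservesFiniteLimits.of_retract ht⟩

/-- The right adjoint of a functor `S` out of presheaves on `C` is the nerve of the restriction
of `S` to `C`. -/
def nerveIsoRightAdjoint {C : Type w} [SmallCategory C] {S : (Cᵒᵖ ⥤ Type w) ⥤ E}
    {R : E ⥤ (Cᵒᵖ ⥤ Type w)} (adj : S ⊣ R) :
    yoneda ⋙ (Functor.whiskeringLeft _ _ (Type w)).obj (yoneda ⋙ S).op ≅ R :=
  NatIso.ofComponents
    (fun X => NatIso.ofComponents
      (fun A => ((adj.homEquiv (yoneda.obj A.unop) X).trans yonedaEquiv).toIso)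
      (fun {A B} f => by
        ext g
        exact (congr_arg yonedaEquiv (adj.homEquiv_naturality_left (yoneda.map f.unop) g)).trans
          (yonedaEquiv_naturality' _ f).symm))
    (fun {X Y} f => by
      ext A g
      exact (congr_arg yonedaEquiv (adj.homEquiv_naturality_right g f)).trans
        (yonedaEquiv_comp _ _))

end Yoneda

end CategoryTheory

/-- Every injective topos is lex totally distributive: if `C` is a small
category with finite limits and the locally small category `E` is a retract, by
geometric morphisms, of `Ĉ` — i.e. there are geometric morphisms `s : E → Ĉ` (direct
image `sStar`, finite-limit-preserving inverse image `sUpper ⊣ sStar`) and `r : Ĉ → E`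
(direct image `rStar`, finite-limit-preserving inverse image `rUpper ⊣ rStar`) with
`sStar ⋙ rStar ≅ 𝟭 E` — then `E` is lex totally distributive. -/
theorem lexTotallyDistributive_of_injective
    {C : Type v} [SmallCategory C] [HasFiniteLimits C] {E : Type u} [Category.{v} E]
    (sStar : E ⥤ (Cᵒᵖ ⥤ Type v)) (sUpper : (Cᵒᵖ ⥤ Type v) ⥤ E)
    (adjS : sUpper ⊣ sStar) [PreservesFiniteLimits sUpper]
    (rStar : (Cᵒᵖ ⥤ Type v) ⥤ E) (rUpper : E ⥤ (Cᵒᵖ ⥤ Type v))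
    (adjR : rUpper ⊣ rStar) [PreservesFiniteLimits rUpper]
    (retr : sStar ⋙ rStar ≅ 𝟭 E) :
    LexTotallyDistributive E := by
  have : IsIdempotentComplete (Type v) := isIdempotentComplete_of_hasEqualizers
  have : IsIdempotentComplete E := .of_comp_iso_id sStar rStar retr
  have : RepresentablyFlat (yoneda ⋙ sUpper : C ⥤ E) := flat_of_preservesFiniteLimits _
  have := lan_op_preservesFiniteLimits_of_flat (yoneda ⋙ sUpper : C ⥤ E)
  exact .of_retraction
    ((Functor.whiskeringLeft _ _ (Type v)).obj (yoneda ⋙ sUpper : C ⥤ E).op ⋙ rStar)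
    (Functor.isoWhiskerRight (nerveIsoRightAdjoint adjS) rStar ≪≫ retr)
    (rUpper ⋙ (yoneda ⋙ sUpper : C ⥤ E).op.lan)
    (adjR.comp ((yoneda ⋙ sUpper : C ⥤ E).op.lanAdjunction (Type v)))
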